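/- There exists a set of 20 points in the plane in general position that contains no 5-crossing family. -/

import Mathlib

/-- A finite set of points in the plane is in *general position* if no three of
its points are collinear. -/
def GenPos (S : Finset (ℝ × ℝ)) : Prop :=
  ∀ p ∈ S, ∀ q ∈ S, ∀ r ∈ S, p ≠ q → p ≠ r → q ≠ r →
    ¬Collinear ℝ ({p, q, r} : Set (ℝ × ℝ))

/-- Two closed segments `pq` and `rs` *cross* if they intersect in exactly one
point, which lies in the interior of both segments. -/
def Crosses (p q r s : ℝ × ℝ) : Prop :=
  ∃ x : ℝ × ℝ, x ∈ openSegment ℝ p q ∧ x ∈ openSegment ℝ r s ∧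
    segment ℝ p q ∩ segment ℝ r s = {x}

/-- `F` is a *crossing family* in `S`: a finite set of segments (given by their
pairs of distinct endpoints, which belong to `S`) that pairwise cross. -/
def IsCrossingFamily (S : Finset (ℝ × ℝ)) (F : Finset ((ℝ × ℝ) × (ℝ × ℝ))) : Prop :=
  (∀ e ∈ F, e.1 ∈ S ∧ e.2 ∈ S ∧ e.1 ≠ e.2) ∧
  (∀ e ∈ F, ∀ f ∈ F, e ≠ f → Crosses e.1 e.2 f.1 f.2)

/-- `S` contains a `k`-crossing family. -/
def HasCrossingFamily (S : Finset (ℝ × ℝ)) (k : ℕ) : Prop :=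
  ∃ F : Finset ((ℝ × ℝ) × (ℝ × ℝ)), IsCrossingFamily S F ∧ F.card = k

/-- `cf S`: the maximum size of a crossing family in `S`. -/
noncomputable def cf (S : Finset (ℝ × ℝ)) : ℕ :=
  sSup {k : ℕ | HasCrossingFamily S k}

/-- `cfNat n`: the minimum of `cf S` over all sets `S` of `n` points in
general position. -/
noncomputable def cfNat (n : ℕ) : ℕ :=
  sInf {m : ℕ | ∃ S : Finset (ℝ × ℝ), S.card = n ∧ GenPos S ∧ cf S = m}

/-- Twice the signed area of the triangle `pqr`. -/
def orient (p q r : ℝ × ℝ) : ℝ :=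
  (q.1 - p.1) * (r.2 - p.2) - (q.2 - p.2) * (r.1 - p.1)

lemma orient_swap (p q r : ℝ × ℝ) :
    orient q p r = -orient p q r := by
  simp only [orient]; ring

lemma Collinear.orient_eq_zero {p q r : ℝ × ℝ}
    (h : Collinear ℝ ({p, q, r} : Set (ℝ × ℝ))) : orient p q r = 0 := by
  obtain ⟨v, hv⟩ := (collinear_iff_of_mem (p₀ := p) (by simp)).1 h
  obtain ⟨a, rfl⟩ := hv q (by simp)
  obtain ⟨b, rfl⟩ := hv r (by simp)
  simp only [orient, vadd_eq_add, Prod.fst_add, Prod.snd_add, Prod.smul_fst, Prod.smul_snd,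
    smul_eq_mul]
  ring

lemma Crosses.symm {p q r s : ℝ × ℝ} (h : Crosses p q r s) : Crosses r s p q := by
  obtain ⟨x, hx, hx', h⟩ := h
  exact ⟨x, hx', hx, Set.inter_comm _ _ ▸ h⟩

/-- The endpoints of a segment crossing `pq` lie on opposite sides of `pq`, unless all four
endpoints are collinear. -/
lemma Crosses.orient_mul_neg_or {p q r s : ℝ × ℝ} (h : Crosses p q r s) :
    orient p q r * orient p q s < 0 ∨ orient p q r = 0 ∧ orient p q s = 0 := by
  obtain ⟨x, ⟨a, b, -, -, hab, rfl⟩, ⟨c, d, hc, hd, hcd, hx⟩, -⟩ := h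
  have h1 := congrArg Prod.fst hx
  have h2 := congrArg Prod.snd hx
  simp only [Prod.fst_add, Prod.snd_add, Prod.smul_fst, Prod.smul_snd, smul_eq_mul] at h1 h2
  have key : c * orient p q r + d * orient p q s = 0 := by
    obtain rfl : a = 1 - b := by linarith
    obtain rfl : c = 1 - d := by linarith
    simp only [orient]
    linear_combination (q.1 - p.1) * h2 - (q.2 - p.2) * h1
  by_cases hr : orient p q r = 0
  · right
    refine ⟨hr, ?_⟩
    rw [hr, mul_zero, zero_add] at key
    exact (mul_eq_zero.1 key).resolve_left hd.ne'
  · left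
    have : 0 < orient p q r ^ 2 := by positivity
    have : d * (orient p q r * orient p q s) = -(c * orient p q r ^ 2) := by
      linear_combination orient p q r * key
    by_contra! hn
    nlinarith [mul_nonneg hd.le hn, mul_pos hc ‹0 < orient p q r ^ 2›]

/-- The triangle `pqr` of grid points is traversed counterclockwise; see `ccw_iff`. -/
def Ccw (p q r : ℕ × ℕ) : Prop :=
  q.2 * r.1 + p.1 * r.2 + q.1 * p.2 < q.1 * r.2 + p.2 * r.1 + p.1 * q.2

instance (p q r : ℕ × ℕ) : Decidable (Ccw p q r) := inferInstanceAs (Decidable (_ < _))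

/-- The endpoints of `f` lie strictly on opposite sides of the line through `e`. -/
def Separates (e f : (ℕ × ℕ) × (ℕ × ℕ)) : Prop :=
  Ccw e.1 e.2 f.1 ∧ Ccw e.2 e.1 f.2 ∨ Ccw e.2 e.1 f.1 ∧ Ccw e.1 e.2 f.2

instance : DecidableRel Separates := fun _ _ => inferInstanceAs (Decidable (_ ∨ _))

/-- Each of `e` and `f` has its endpoints strictly on opposite sides of the other. -/
def Straddle (e f : (ℕ × ℕ) × (ℕ × ℕ)) : Prop :=
  Separates e f ∧ Separates f e

instance : DecidableRel Straddle := fun _ _ => inferInstanceAs (Decidable (_ ∧ _))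

lemma not_straddle_self (e : (ℕ × ℕ) × (ℕ × ℕ)) : ¬Straddle e e := by
  simp only [Straddle, Separates, Ccw]; lia

lemma straddle_swap_left {e f : (ℕ × ℕ) × (ℕ × ℕ)} : Straddle e.swap f ↔ Straddle e f := by
  simp only [Straddle, Separates, Prod.fst_swap, Prod.snd_swap]; tauto

lemma straddle_swap_right {e f : (ℕ × ℕ) × (ℕ × ℕ)} : Straddle e f.swap ↔ Straddle e f := by
  simp only [Straddle, Separates, Prod.fst_swap, Prod.snd_swap]; tauto

/-- Exhaustive search certifying that `l` has no `k` pairwise `r`-related elements. -/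
def noClique {α : Type*} (r : α → α → Prop) [DecidableRel r] : ℕ → List α → Bool
  | 0 => fun _ => false
  | k + 1 => List.rec true fun e l ih => noClique r k (l.filter (r e ·)) && ih

lemma card_ne_of_noClique {α : Type*} {r : α → α → Prop} [DecidableRel r] {k : ℕ}
    {l : List α} (h : noClique r k l = true) {T : Finset α} (hT : ∀ e ∈ T, e ∈ l)
    (hr : ∀ e ∈ T, ∀ f ∈ T, e ≠ f → r e f) : T.card ≠ k := by
  classical
  induction k generalizing l T with
  | zero => simp [noClique] at h
  | succ k ihk =>
    induction l with
    | nil =>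
      obtain rfl : T = ∅ := Finset.eq_empty_of_forall_notMem fun e he => by simpa using hT e he
      simp
    | cons e l ihl =>
      obtain ⟨h1, h2⟩ := (Bool.and_eq_true _ _).mp h
      by_cases he : e ∈ T
      · have := ihk h1 (T := T.erase e)
          (fun f hf => by
            obtain ⟨hfe, hf⟩ := Finset.mem_erase.1 hf
            exact List.mem_filter.2 ⟨(List.mem_cons.1 (hT f hf)).resolve_left hfe,
              by simpa using hr e he f hf hfe.symm⟩)
          (fun f hf g hg =>
            hr f (Finset.mem_of_mem_erase hf) g (Finset.mem_of_mem_erase hg))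
        rw [Finset.card_erase_of_mem he] at this
        omega
      · exact ihl h2 fun f hf =>
          (List.mem_cons.1 (hT f hf)).resolve_left fun hfe => he (hfe ▸ hf)

/-- All pairs of entries at distinct positions of a list, each taken in one order. -/
def orderedPairs {α : Type*} : List α → List (α × α)
  | [] => []
  | a :: l => l.map (Prod.mk a) ++ orderedPairs l

lemma mem_orderedPairs_or_swap {α : Type*} {l : List α} {e : α × α} (h1 : e.1 ∈ l)
    (h2 : e.2 ∈ l) (hne : e.1 ≠ e.2) : e ∈ orderedPairs l ∨ e.swap ∈ orderedPairs l := by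
  obtain ⟨a, b⟩ := e
  induction l with
  | nil => simp at h1
  | cons c l ih => simp only [orderedPairs, List.mem_append, List.mem_map, Prod.swap]; grind

/-- The embedding of the grid of natural numbers into the plane. -/
def gridPoint : ℕ × ℕ ↪ ℝ × ℝ where
  toFun p := (p.1, p.2)
  inj' p q h := by simpa [Prod.ext_iff] using h

lemma gridPoint_apply (p : ℕ × ℕ) : gridPoint p = ((p.1 : ℝ), (p.2 : ℝ)) := rfl

lemma ccw_iff {p q r : ℕ × ℕ} :
    Ccw p q r ↔ 0 < orient (gridPoint p) (gridPoint q) (gridPoint r) := by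
  rw [Ccw, ← Nat.cast_lt (α := ℝ), ← sub_pos]
  simp only [orient, gridPoint_apply]
  push_cast
  ring_nf

lemma ccw_or_ccw_swap_iff {p q r : ℕ × ℕ} :
    Ccw p q r ∨ Ccw q p r ↔ orient (gridPoint p) (gridPoint q) (gridPoint r) ≠ 0 := by
  rw [ccw_iff, ccw_iff, orient_swap (gridPoint p), neg_pos, or_comm, ne_iff_lt_or_gt]

lemma separates_iff {p q r s : ℕ × ℕ} :
    Separates (p, q) (r, s) ↔ orient (gridPoint p) (gridPoint q) (gridPoint r) *
      orient (gridPoint p) (gridPoint q) (gridPoint s) < 0 := by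
  simp only [Separates, ccw_iff, orient_swap (gridPoint p), neg_pos, mul_neg_iff]

section Grid

variable {P : Finset (ℕ × ℕ)}

lemma genPos_map_gridPoint
    (hP : ∀ p ∈ P, ∀ q ∈ P, ∀ r ∈ P, p ≠ q → p ≠ r → q ≠ r → Ccw p q r ∨ Ccw q p r) :
    GenPos (P.map gridPoint) := by
  simp only [GenPos, Finset.forall_mem_map, gridPoint.injective.ne_iff]
  intro p hp q hq r hr hpq hpr hqr h
  exact ccw_or_ccw_swap_iff.1 (hP p hp q hq r hr hpq hpr hqr) h.orient_eq_zero

lemma separates_of_crosses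
    (hP : ∀ p ∈ P, ∀ q ∈ P, ∀ r ∈ P, p ≠ q → p ≠ r → q ≠ r → Ccw p q r ∨ Ccw q p r)
    {p q r s : ℕ × ℕ} (hp : p ∈ P) (hq : q ∈ P) (hr : r ∈ P) (hs : s ∈ P)
    (hpq : p ≠ q) (hrs : r ≠ s)
    (h : Crosses (gridPoint p) (gridPoint q) (gridPoint r) (gridPoint s)) :
    Separates (p, q) (r, s) := by
  have key := h.orient_mul_neg_or
  refine separates_iff.2 (key.resolve_right fun ⟨h1, h2⟩ => ?_)
  have endpoint (t) (ht : t ∈ P)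
      (h0 : orient (gridPoint p) (gridPoint q) (gridPoint t) = 0) : t = p ∨ t = q := by
    by_contra! hne
    exact ccw_or_ccw_swap_iff.1 (hP p hp q hq t ht hpq hne.1.symm hne.2.symm) h0
  have hr' := endpoint r hr h1
  have hs' := endpoint s hs h2
  obtain ⟨x, -, -, hx⟩ := h
  have hseg : segment ℝ (gridPoint r) (gridPoint s) = segment ℝ (gridPoint p) (gridPoint q) := by
    rcases hr' with rfl | rfl <;> rcases hs' with rfl | rfl
    · exact absurd rfl hrs
    · rfl
    · exact segment_symm ..
    · exact absurd rfl hrs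
  rw [hseg, Set.inter_self] at hx
  have hpx : gridPoint p = x := by simpa [hx] using left_mem_segment ℝ (gridPoint p) (gridPoint q)
  have hqx : gridPoint q = x := by simpa [hx] using right_mem_segment ℝ (gridPoint p) (gridPoint q)
  exact hpq (gridPoint.injective (hpx.trans hqx.symm))

/-- A crossing family of grid points comes from an equally large family of pairwise straddling
segments of the grid, each taken in the order given by `orderedPairs`. -/
lemma exists_straddling_of_hasCrossingFamily
    (hP : ∀ p ∈ P, ∀ q ∈ P, ∀ r ∈ P, p ≠ q → p ≠ r → q ≠ r → Ccw p q r ∨ Ccw q p r)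
    {l : List (ℕ × ℕ)} (hl : ∀ p ∈ P, p ∈ l) {k : ℕ}
    (h : HasCrossingFamily (P.map gridPoint) k) :
    ∃ T : Finset ((ℕ × ℕ) × (ℕ × ℕ)), (∀ e ∈ T, e ∈ orderedPairs l) ∧
      (∀ e ∈ T, ∀ f ∈ T, e ≠ f → Straddle e f) ∧ T.card = k := by
  classical
  obtain ⟨F, ⟨hF, hcross⟩, rfl⟩ := h
  have lift (e) (he : e ∈ F) : ∃ d : (ℕ × ℕ) × (ℕ × ℕ), d.1 ∈ P ∧ d.2 ∈ P ∧ d.1 ≠ d.2 ∧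
      e = (gridPoint d.1, gridPoint d.2) := by
    obtain ⟨h1, h2, hne⟩ := hF e he
    obtain ⟨p, hp, hp'⟩ := Finset.mem_map.1 h1
    obtain ⟨q, hq, hq'⟩ := Finset.mem_map.1 h2
    exact ⟨(p, q), hp, hq, fun hpq : p = q => hne (by rw [← hp', ← hq', hpq]),
      Prod.ext hp'.symm hq'.symm⟩
  choose! d hd1 hd2 hdne hd using lift
  have hstr (e) (he : e ∈ F) (f) (hf : f ∈ F) (hne : e ≠ f) : Straddle (d e) (d f) := by
    have hc := hcross e he f hf hne
    rw [hd e he, hd f hf] at hc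
    exact ⟨separates_of_crosses hP (hd1 e he) (hd2 e he) (hd1 f hf) (hd2 f hf)
        (hdne e he) (hdne f hf) hc,
      separates_of_crosses hP (hd1 f hf) (hd2 f hf) (hd1 e he) (hd2 e he)
        (hdne f hf) (hdne e he) hc.symm⟩
  let g e := if d e ∈ orderedPairs l then d e else (d e).swap
  have hg (e) (he : e ∈ F) (f) (hf : f ∈ F) (hne : e ≠ f) : Straddle (g e) (g f) := by
    have := hstr e he f hf hne
    simp only [g]
    split_ifs <;> simpa only [straddle_swap_left, straddle_swap_right]
  refine ⟨F.image g, ?_, ?_, Finset.card_image_of_injOn fun e he f hf hef => ?_⟩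
  · simp only [Finset.forall_mem_image, g]
    intro e he
    have := mem_orderedPairs_or_swap (hl _ (hd1 e he)) (hl _ (hd2 e he)) (hdne e he)
    split_ifs with h
    · exact h
    · exact this.resolve_left h
  · simp only [Finset.forall_mem_image]
    exact fun e he f hf hne => hg e he f hf fun hef => hne (hef ▸ rfl)
  · by_contra hne
    have := hg e he f hf hne
    rw [hef] at this
    exact not_straddle_self _ this

end Grid

/-- Twenty grid points without a 5-crossing family. -/
def twentyPoints : List (ℕ × ℕ) :=
  [(5521, 6924), (3093, 1281), (5983, 733), (4696, 3206), (3232, 1653),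
   (5059, 4001), (5891, 744), (0, 0), (4957, 919), (3537, 1242),
   (1959, 660), (2821, 1457), (1988, 697), (2741, 1230), (4378, 1156),
   (5463, 843), (6223, 8948), (3601, 1333), (656, 238), (3238, 1451)]

lemma ccw_or_of_mem_twentyPoints :
    ∀ p ∈ twentyPoints, ∀ q ∈ twentyPoints, ∀ r ∈ twentyPoints,
      p ≠ q → p ≠ r → q ≠ r → Ccw p q r ∨ Ccw q p r := by
  decide +kernel

lemma noClique_twentyPoints : noClique Straddle 5 (orderedPairs twentyPoints) = true := by
  decide +kernel

/-- There exists a set of 20 points in the plane in general position that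
contains no 5-crossing family. -/
theorem exists_20_points_without_5_crossing_family :
    ∃ S : Finset (ℝ × ℝ), S.card = 20 ∧ GenPos S ∧ ¬ HasCrossingFamily S 5 := by
  have hP : ∀ p ∈ twentyPoints.toFinset, ∀ q ∈ twentyPoints.toFinset,
      ∀ r ∈ twentyPoints.toFinset, p ≠ q → p ≠ r → q ≠ r → Ccw p q r ∨ Ccw q p r := by
    simpa only [List.mem_toFinset] using ccw_or_of_mem_twentyPoints
  refine ⟨twentyPoints.toFinset.map gridPoint, ?_, genPos_map_gridPoint hP, fun h => ?_⟩
  · rw [Finset.card_map]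
    decide +kernel
  · obtain ⟨T, hT, hr, hcard⟩ :=
      exists_straddling_of_hasCrossingFamily hP (fun p hp => List.mem_toFinset.1 hp) h
    exact card_ne_of_noClique noClique_twentyPoints hT hr hcard
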